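/- arXiv:1506.03037 — 2 statements merged into one kernel-verified Lean document; each statement's English description precedes it below -/
import Mathlib

section
/- For every k ≥ 1 and every linear operator F on H with ‖F‖_E = 1, one has ∑_{α∈S^k} ⟨A(α)F, A(α)⟩_E² ≤ max_{α∈S^k} ν(α). In particular, if ν(α) < 1 for all α ∈ S^k, then the irreducibility constant c_k := inf{ ∑_{α∈S^k} ⟨A(α)F, A(α)⟩_E² : F self-adjoint, ‖F‖_E = 1, ⟨F,I⟩_E = 0 } is strictly less than 1. -/
open MeasureTheory Matrix
open scoped ComplexOrder

/-- The compound restriction map `A(α) = A_{α₁} ⋯ A_{α_n}` of a word `α ∈ S^n`. -/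
noncomputable def wordMap {S : Type*} {d : Type*} [Fintype d] [DecidableEq d]
    (A : S → Matrix d d ℂ) {n : ℕ} (α : Fin n → S) : Matrix d d ℂ :=
  (List.ofFn fun i => A (α i)).prod

/-- The inner product `⟨A,B⟩_E = Tr(B* E A)` on the space of operators. -/
noncomputable def innerE {d : Type*} [Fintype d] [DecidableEq d]
    (E X Y : Matrix d d ℂ) : ℂ :=
  (Yᴴ * E * X).trace

/-- The associated norm `‖A‖_E = ⟨A,A⟩_E^{1/2}`. -/
noncomputable def normE {d : Type*} [Fintype d] [DecidableEq d]
    (E X : Matrix d d ℂ) : ℝ :=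
  Real.sqrt (innerE E X X).re

/-- `ν(α) = Tr(A(α)* E A(α))`. -/
noncomputable def nuWord {S : Type*} {d : Type*} [Fintype d] [DecidableEq d]
    (A : S → Matrix d d ℂ) (E : Matrix d d ℂ) {n : ℕ} (α : Fin n → S) : ℝ :=
  (((wordMap A α)ᴴ * E * wordMap A α).trace).re

theorem wordMap_cons {S : Type*} {d : Type*} [Fintype d] [DecidableEq d]
    (A : S → Matrix d d ℂ) {n : ℕ} (s : S) (α : Fin n → S) :
    wordMap A (Fin.cons s α : Fin (n + 1) → S) = A s * wordMap A α := by
  simp [wordMap, List.ofFn_succ]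

/-- The relation `∑ A_s* E A_s = E` propagates to words of any length. -/
theorem sum_conjTranspose_wordMap_mul_mul_wordMap {S : Type*} [Fintype S]
    {d : Type*} [Fintype d] [DecidableEq d] {A : S → Matrix d d ℂ} {E : Matrix d d ℂ}
    (h : ∑ s : S, (A s)ᴴ * E * A s = E) (n : ℕ) :
    ∑ α : Fin n → S, (wordMap A α)ᴴ * E * wordMap A α = E := by
  induction n with
  | zero => simp [wordMap]
  | succ n ih =>
    rw [← (Fin.consEquiv fun _ => S).sum_comp, Fintype.sum_prod_type_right]
    calc ∑ α : Fin n → S, ∑ s : S,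
          (wordMap A (Fin.cons s α : Fin (n + 1) → S))ᴴ * E *
            wordMap A (Fin.cons s α : Fin (n + 1) → S)
        = ∑ α : Fin n → S,
            (wordMap A α)ᴴ * (∑ s : S, (A s)ᴴ * E * A s) * wordMap A α := by
          simp only [wordMap_cons, conjTranspose_mul, Matrix.mul_sum, Matrix.sum_mul,
            Matrix.mul_assoc]
      _ = E := by rw [h, ih]

theorem innerE_self_re_nonneg {d : Type*} [Fintype d] [DecidableEq d]
    {E : Matrix d d ℂ} (hE : E.PosSemidef) (X : Matrix d d ℂ) : 0 ≤ (innerE E X X).re :=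
  (Complex.le_def.mp (hE.conjTranspose_mul_mul_same X).trace_nonneg).1

/-- The Cauchy–Schwarz inequality for `⟨·,·⟩_E`. -/
theorem norm_innerE_sq_le {d : Type*} [Fintype d] [DecidableEq d]
    {E : Matrix d d ℂ} (hE : E.PosSemidef) (X Y : Matrix d d ℂ) :
    ‖innerE E X Y‖ ^ 2 ≤ (innerE E X X).re * (innerE E Y Y).re := by
  let := E.toMatrixSeminormedAddCommGroup hE
  let := E.toMatrixInnerProductSpace hE
  have inner_eq (X Y : Matrix d d ℂ) : inner ℂ Xᴴ Yᴴ = innerE E X Y := by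
    change (Yᴴ * E * Xᴴᴴ).trace = _
    rw [conjTranspose_conjTranspose, innerE]
  have h := inner_mul_inner_self_le (𝕜 := ℂ) Xᴴ Yᴴ
  rw [norm_inner_symm Yᴴ Xᴴ] at h
  simpa only [inner_eq, ← sq, RCLike.re_eq_complex_re] using h

theorem sum_innerE_wordMap_mul_self {S : Type*} [Fintype S]
    {d : Type*} [Fintype d] [DecidableEq d] {A : S → Matrix d d ℂ} {E : Matrix d d ℂ}
    (h : ∑ s : S, (A s)ᴴ * E * A s = E) (n : ℕ) (F : Matrix d d ℂ) :
    ∑ α : Fin n → S, innerE E (wordMap A α * F) (wordMap A α * F) = innerE E F F := by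
  calc ∑ α : Fin n → S, innerE E (wordMap A α * F) (wordMap A α * F)
      = (Fᴴ * (∑ α : Fin n → S, (wordMap A α)ᴴ * E * wordMap A α) * F).trace := by
        simp only [innerE, conjTranspose_mul, Matrix.mul_sum, Matrix.sum_mul, trace_sum,
          Matrix.mul_assoc]
    _ = innerE E F F := by rw [sum_conjTranspose_wordMap_mul_mul_wordMap h, innerE]

theorem sum_norm_innerE_sq_le_sup_nuWord {S : Type*} [Fintype S] [Nonempty S]
    {d : Type*} [Fintype d] [DecidableEq d] {A : S → Matrix d d ℂ} {E : Matrix d d ℂ}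
    (hE : E.PosSemidef) (h : ∑ s : S, (A s)ᴴ * E * A s = E) (n : ℕ) {F : Matrix d d ℂ}
    (hF : normE E F = 1) :
    ∑ α : Fin n → S, ‖innerE E (wordMap A α * F) (wordMap A α)‖ ^ 2 ≤
      Finset.univ.sup' Finset.univ_nonempty (fun α : Fin n → S => nuWord A E α) := by
  set M := Finset.univ.sup' Finset.univ_nonempty (fun α : Fin n → S => nuWord A E α)
  calc ∑ α : Fin n → S, ‖innerE E (wordMap A α * F) (wordMap A α)‖ ^ 2
      ≤ ∑ α : Fin n → S, (innerE E (wordMap A α * F) (wordMap A α * F)).re * M := by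
        refine Finset.sum_le_sum fun α _ => (norm_innerE_sq_le hE _ _).trans ?_
        exact mul_le_mul_of_nonneg_left
          (Finset.le_sup' (fun α : Fin n → S => nuWord A E α) (Finset.mem_univ α))
          (innerE_self_re_nonneg hE _)
    _ = M := by
        rw [← Finset.sum_mul, ← Complex.re_sum, sum_innerE_wordMap_mul_self h,
          Real.sqrt_eq_one.mp hF, one_mul]

/-- for `k ≥ 1` and any operator `F` with `‖F‖_E = 1`,
`∑_{α∈S^k} ⟨A(α)F, A(α)⟩_E² ≤ max_{α∈S^k} ν(α)`; in particular, if `ν(α) < 1` for all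
`α ∈ S^k` then the irreducibility constant `c_k < 1`. -/
theorem irreducibility_constant_lt_one
    {S : Type*} [Fintype S] [Nonempty S]
    {d : Type*} [Fintype d] [DecidableEq d]
    (A : S → Matrix d d ℂ) (E : Matrix d d ℂ)
    (hE : E.PosDef) (hTrE : E.trace = 1)
    (hfund1 : ∑ s : S, (A s)ᴴ * E * A s = E)
    (hfund2 : ∑ s : S, A s * (A s)ᴴ = 1)
    (k : ℕ) (hk : 1 ≤ k) :
    (∀ F : Matrix d d ℂ, normE E F = 1 →
      ∑ α : Fin k → S, ‖innerE E (wordMap A α * F) (wordMap A α)‖ ^ 2 ≤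
        Finset.univ.sup' Finset.univ_nonempty (fun α : Fin k → S => nuWord A E α)) ∧
    ((∀ α : Fin k → S, nuWord A E α < 1) →
      sInf {v : ℝ | ∃ F : Matrix d d ℂ, F.IsHermitian ∧ normE E F = 1 ∧
          innerE E F 1 = 0 ∧
          v = ∑ α : Fin k → S, ‖innerE E (wordMap A α * F) (wordMap A α)‖ ^ 2} < 1) := by
  have bound (F : Matrix d d ℂ) (hF : normE E F = 1) :=
    sum_norm_innerE_sq_le_sup_nuWord hE.posSemidef hfund1 k hF
  refine ⟨bound, fun hν => ?_⟩
  set V := {v : ℝ | ∃ F : Matrix d d ℂ, F.IsHermitian ∧ normE E F = 1 ∧ innerE E F 1 = 0 ∧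
    v = ∑ α : Fin k → S, ‖innerE E (wordMap A α * F) (wordMap A α)‖ ^ 2}
  have hV : BddBelow V := ⟨0, by
    rintro _ ⟨F, -, -, -, rfl⟩
    positivity⟩
  rcases V.eq_empty_or_nonempty with hempty | ⟨v, hv⟩
  · simp [hempty]
  · refine (csInf_le hV hv).trans_lt ?_
    obtain ⟨F, -, hF, -, rfl⟩ := hv
    exact (bound F hF).trans_lt ((Finset.sup'_lt_iff _).mpr fun α _ => hν α)
end

section
/- For the Kusuoka measure ν of the Sierpiński gasket system on X = {0,1,2}^{ℤ₊}: for every k ≥ 0, every 𝓕_k-measurable function f ∈ L¹(X,ν) and every n ≥ 0, ‖L^{n+k} f − ∫ f dν‖_{L^∞(ν)} ≤ 2 (4/5)ⁿ ‖f‖_{L¹(ν)}, where ‖·‖_{L^∞(ν)} denotes the essential supremum norm and L is the transfer operator. -/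
open MeasureTheory Matrix
open scoped ENNReal

/-- Rotation of the plane by the angle `2π/3`. -/
noncomputable def sgRot : Matrix (Fin 2) (Fin 2) ℝ :=
  !![Real.cos (2 * Real.pi / 3), -Real.sin (2 * Real.pi / 3);
     Real.sin (2 * Real.pi / 3),  Real.cos (2 * Real.pi / 3)]

/-- The diagonal matrix `D = diag(3/√15, 1/√15)`. -/
noncomputable def sgD : Matrix (Fin 2) (Fin 2) ℝ :=
  !![3 / Real.sqrt 15, 0; 0, 1 / Real.sqrt 15]

/-- The Sierpiński gasket restriction maps `A_s = R^{-s} D R^{s}`, `s ∈ {0,1,2}`. -/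
noncomputable def sgA (s : Fin 3) : Matrix (Fin 2) (Fin 2) ℝ :=
  (sgRot ^ (s : ℕ))⁻¹ * sgD * sgRot ^ (s : ℕ)

/-- The compound map `A(α) = A_{α₁} ⋯ A_{α_n}` of a word `α ∈ {0,1,2}^n`. -/
noncomputable def sgW {n : ℕ} (α : Fin n → Fin 3) : Matrix (Fin 2) (Fin 2) ℝ :=
  (List.ofFn fun i => sgA (α i)).prod

/-- The cylinder set `[α]` of a word `α`. -/
def cylinder {S : Type*} {n : ℕ} (α : Fin n → S) : Set (ℕ → S) :=
  {x | ∀ i : Fin n, x (i : ℕ) = α i}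

/-- The left shift `(Tx)(n) = x(n+1)`. -/
def shift {S : Type*} : (ℕ → S) → ℕ → S := fun x n => x (n + 1)

/-- The σ-algebra `𝓕_n` generated by the cylinder sets of length `n`. -/
def cylAlgebra (S : Type*) [MeasurableSpace S] (n : ℕ) : MeasurableSpace (ℕ → S) :=
  MeasurableSpace.comap (fun (x : ℕ → S) (i : Fin n) => x (i : ℕ)) inferInstance

open Filter Topology

section Matrices

lemma sgRot_eq : sgRot = !![-1 / 2, -(√3 / 2); √3 / 2, -1 / 2] := by
  have h : 2 * Real.pi / 3 = Real.pi - Real.pi / 3 := by ring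
  rw [sgRot, h, Real.cos_pi_sub, Real.sin_pi_sub, Real.cos_pi_div_three,
    Real.sin_pi_div_three]
  norm_num

lemma sgRot_inv : sgRot⁻¹ = !![-1 / 2, √3 / 2; -(√3 / 2), -1 / 2] := by
  have h3 : √3 * √3 = 3 := Real.mul_self_sqrt (by norm_num)
  refine Matrix.inv_eq_left_inv ?_
  rw [sgRot_eq]
  ext i j
  fin_cases i <;> fin_cases j <;> simp [Matrix.mul_apply, Fin.sum_univ_two] <;> nlinarith

lemma sgRot_sq : sgRot ^ 2 = sgRot⁻¹ := by
  have h3 : √3 * √3 = 3 := Real.mul_self_sqrt (by norm_num)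
  rw [sgRot_inv, sgRot_eq, pow_two]
  ext i j
  fin_cases i <;> fin_cases j <;> simp [Matrix.mul_apply, Fin.sum_univ_two] <;> nlinarith

lemma sgD_eq : sgD = (√15)⁻¹ • !![3, 0; 0, 1] := by
  ext i j
  fin_cases i <;> fin_cases j <;> simp [sgD, div_eq_mul_inv, mul_comm]

lemma sgA_zero : sgA 0 = (√15)⁻¹ • !![3, 0; 0, 1] := by
  simp [sgA, sgD_eq]

lemma sgA_one : sgA 1 = (√15)⁻¹ • !![3 / 2, √3 / 2; √3 / 2, 5 / 2] := by
  have h3 : √3 * √3 = 3 := Real.mul_self_sqrt (by norm_num)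
  rw [sgA, sgD_eq, Matrix.mul_smul, Matrix.smul_mul]
  congr 1
  simp only [Fin.val_one, pow_one]
  rw [sgRot_inv, sgRot_eq]
  ext i j
  fin_cases i <;> fin_cases j <;> simp [Matrix.mul_apply, Fin.sum_univ_two] <;> nlinarith

lemma sgA_two : sgA 2 = (√15)⁻¹ • !![3 / 2, -(√3 / 2); -(√3 / 2), 5 / 2] := by
  have h3 : √3 * √3 = 3 := Real.mul_self_sqrt (by norm_num)
  rw [sgA, sgD_eq, Matrix.mul_smul, Matrix.smul_mul]
  congr 1
  have hdet : IsUnit sgRot.det := by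
    rw [sgRot_eq, Matrix.det_fin_two_of]
    refine isUnit_iff_ne_zero.2 ?_
    nlinarith
  simp only [Fin.val_two]
  rw [sgRot_sq, Matrix.nonsing_inv_nonsing_inv _ hdet, sgRot_inv, sgRot_eq]
  ext i j
  fin_cases i <;> fin_cases j <;> simp [Matrix.mul_apply, Fin.sum_univ_two] <;> nlinarith

/-- On symmetric matrices, `B ↦ ∑ s, A_s B A_sᵀ` fixes the identity and contracts the traceless
part by the factor `4/5`. -/
lemma sum_sgA_conj (B : Matrix (Fin 2) (Fin 2) ℝ) (hB : Bᵀ = B) :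
    ∑ s, sgA s * B * (sgA s)ᵀ = (4 / 5 : ℝ) • B + (B.trace / 10) • 1 := by
  have h3 : √3 ^ 2 = 3 := Real.sq_sqrt (by norm_num)
  have h15 : (√15)⁻¹ * (√15)⁻¹ = (15 : ℝ)⁻¹ := by
    rw [← mul_inv, Real.mul_self_sqrt (by norm_num)]
  have h10 : B 1 0 = B 0 1 := congrFun (congrFun hB 0) 1
  rw [Fin.sum_univ_three, sgA_zero, sgA_one, sgA_two]
  simp only [Matrix.transpose_smul, Matrix.smul_mul, Matrix.mul_smul, smul_smul, h15]
  rw [Matrix.eta_fin_two B, h10]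
  generalize B 0 0 = a, B 0 1 = b, B 1 1 = d
  ext i j
  fin_cases i <;> fin_cases j <;>
    simp [-Matrix.cons_mul, Matrix.mul_apply, Fin.sum_univ_two, Matrix.trace_fin_two] <;>
    ring_nf <;> simp only [h3] <;> ring

/-- For `P = AᵀA` and `B = CCᵀ`, `Tr (PB) / 2` lies in `[0, Tr P Tr B / 2]`, so it differs from
`Tr P Tr B / 4` by at most `Tr P Tr B / 4`. -/
lemma abs_trace_mul_sub_le (A C : Matrix (Fin 2) (Fin 2) ℝ) :
    |1 / 2 * (A * (C * Cᵀ) * Aᵀ).trace - 1 / 4 * (A * Aᵀ).trace * (C * Cᵀ).trace| ≤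
      1 / 4 * (A * Aᵀ).trace * (C * Cᵀ).trace := by
  simp only [Matrix.trace_fin_two, Matrix.mul_apply, Fin.sum_univ_two, Matrix.transpose_apply]
  rw [abs_le]
  constructor
  · nlinarith [sq_nonneg (A 0 0 * C 0 0 + A 0 1 * C 1 0),
      sq_nonneg (A 0 0 * C 0 1 + A 0 1 * C 1 1),
      sq_nonneg (A 1 0 * C 0 0 + A 1 1 * C 1 0),
      sq_nonneg (A 1 0 * C 0 1 + A 1 1 * C 1 1)]
  · nlinarith [sq_nonneg (A 0 0 * C 1 0 - A 0 1 * C 0 0),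
      sq_nonneg (A 0 0 * C 1 1 - A 0 1 * C 0 1),
      sq_nonneg (A 1 0 * C 1 0 - A 1 1 * C 0 0),
      sq_nonneg (A 1 0 * C 1 1 - A 1 1 * C 0 1)]

lemma sgW_append {m n : ℕ} (α : Fin m → Fin 3) (β : Fin n → Fin 3) :
    sgW (Fin.append α β) = sgW α * sgW β := by
  rw [sgW, sgW, sgW, ← List.prod_append, ← List.ofFn_fin_append]
  congr 2
  ext1 i
  refine Fin.addCases (fun i => ?_) (fun i => ?_) i <;> simp

lemma sgW_cons {n : ℕ} (s : Fin 3) (β : Fin n → Fin 3) :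
    sgW (Fin.cons s β : Fin (n + 1) → Fin 3) = sgA s * sgW β := by
  simp [sgW, List.ofFn_succ]

end Matrices

section Cylinders

variable {S : Type*}

lemma shift_iterate_apply (m : ℕ) (x : ℕ → S) (i : ℕ) : shift^[m] x i = x (i + m) := by
  induction m generalizing x with
  | zero => rfl
  | succ m ih => rw [Function.iterate_succ_apply, ih, shift, add_assoc]

lemma mem_cylinder_iff {n : ℕ} {α : Fin n → S} {x : ℕ → S} :
    x ∈ cylinder α ↔ (fun i : Fin n => x i) = α :=
  funext_iff.symm

lemma cylinder_append {m n : ℕ} (α : Fin m → S) (β : Fin n → S) :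
    cylinder (Fin.append α β) = cylinder α ∩ shift^[m] ⁻¹' cylinder β := by
  ext x
  constructor
  · intro h
    refine ⟨fun i => ?_, fun i => ?_⟩
    · simpa using h (Fin.castAdd n i)
    · simpa [shift_iterate_apply, add_comm] using h (Fin.natAdd m i)
  · rintro ⟨h₁, h₂⟩ i
    refine Fin.addCases (fun i => ?_) (fun i => ?_) i
    · simpa using h₁ i
    · simpa [shift_iterate_apply, add_comm] using h₂ i

lemma shift_preimage_cylinder {n : ℕ} (β : Fin n → S) :
    shift ⁻¹' cylinder β = ⋃ s, cylinder (Fin.cons s β : Fin (n + 1) → S) := by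
  ext x
  simp only [Set.mem_preimage, Set.mem_iUnion]
  constructor
  · intro h
    refine ⟨x 0, fun i => ?_⟩
    refine Fin.cases (by simp) (fun i => ?_) i
    simpa [shift] using h i
  · rintro ⟨s, h⟩ i
    simpa [shift] using h i.succ

lemma disjoint_cylinder {n : ℕ} {α β : Fin n → S} (h : α ≠ β) :
    Disjoint (cylinder α) (cylinder β) :=
  Set.disjoint_left.2 fun _ hα hβ => h ((mem_cylinder_iff.1 hα).symm.trans (mem_cylinder_iff.1 hβ))

variable [MeasurableSpace S]

lemma cylAlgebra_le (n : ℕ) : cylAlgebra S n ≤ MeasurableSpace.pi :=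
  Measurable.comap_le (measurable_pi_lambda _ fun _ => measurable_pi_apply _)

lemma cylAlgebra_mono : Monotone (cylAlgebra S) := by
  intro m n h
  refine Measurable.comap_le
    (@measurable_pi_lambda _ _ _ (cylAlgebra S n) _ _ fun i => ?_)
  exact (measurable_pi_apply (X := fun _ : Fin n => S) (Fin.castLE h i)).comp (comap_measurable _)

lemma iSup_cylAlgebra : ⨆ n, cylAlgebra S n = MeasurableSpace.pi := by
  refine le_antisymm (iSup_le cylAlgebra_le) (iSup_le fun i => ?_)
  refine le_trans ?_ (le_iSup _ (i + 1))
  refine Measurable.comap_le ?_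
  exact (measurable_pi_apply (X := fun _ : Fin (i + 1) => S) (Fin.last i)).comp (comap_measurable _)

lemma measurableSet_cylinder [MeasurableSingletonClass S] {n : ℕ} (α : Fin n → S) :
    MeasurableSet[cylAlgebra S n] (cylinder α) :=
  ⟨{α}, MeasurableSet.singleton α, by ext x; exact mem_cylinder_iff.symm⟩

/-- The filtration of the cylinder σ-algebras. -/
def cylFiltration (S : Type*) [MeasurableSpace S] :
    Filtration ℕ (MeasurableSpace.pi : MeasurableSpace (ℕ → S)) where
  seq := cylAlgebra S
  mono' := cylAlgebra_mono
  le' := cylAlgebra_le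

lemma exists_eq_of_measurable_cylAlgebra {n : ℕ} {f : (ℕ → S) → ℝ}
    (hf : Measurable[cylAlgebra S n] f) :
    ∃ c : (Fin n → S) → ℝ, ∀ (α : Fin n → S), ∀ x ∈ cylinder α, f x = c α := by
  obtain ⟨c, -, hc⟩ := hf.exists_eq_measurable_comp
  refine ⟨c, fun α x hx => ?_⟩
  rw [hc, Function.comp_apply, mem_cylinder_iff.1 hx]

variable [Fintype S] [MeasurableSingletonClass S] {ν : Measure (ℕ → S)} [IsProbabilityMeasure ν]

lemma setIntegral_eq_sum_cylinder {n : ℕ} {f : (ℕ → S) → ℝ} {c : (Fin n → S) → ℝ}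
    (hc : ∀ (α : Fin n → S), ∀ x ∈ cylinder α, f x = c α) (E : Set (ℕ → S)) :
    ∫ x in E, f x ∂ν = ∑ α, c α * ν.real (cylinder α ∩ E) := by
  have hm (α : Fin n → S) : MeasurableSet (cylinder α) :=
    cylAlgebra_le n _ (measurableSet_cylinder α)
  have hf : f = fun x => ∑ α : Fin n → S, (cylinder α).indicator (fun _ => c α) x := by
    funext x
    rw [Finset.sum_eq_single (fun i : Fin n => x i)]
    · rw [Set.indicator_of_mem (mem_cylinder_iff.2 rfl)]
      exact hc _ x (mem_cylinder_iff.2 rfl)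
    · intro α _ hα
      exact Set.indicator_of_notMem (fun h => hα (mem_cylinder_iff.1 h).symm) _
    · simp
  rw [hf, integral_finsetSum _ fun α _ => (integrable_const _).indicator (hm α)]
  refine Finset.sum_congr rfl fun α _ => ?_
  rw [integral_indicator (hm α), setIntegral_const, smul_eq_mul, mul_comm,
    measureReal_restrict_apply (hm α)]

/-- A function whose averages over all cylinders are bounded by `C` is bounded by `C` almost
everywhere. -/
lemma ae_abs_le_of_cylinder {h : (ℕ → S) → ℝ} (hh : Integrable h ν) {C : ℝ}
    (hC : ∀ (m : ℕ) (β : Fin m → S), |∫ x in cylinder β, h x ∂ν| ≤ C * ν.real (cylinder β)) :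
    ∀ᵐ x ∂ν, |h x| ≤ C := by
  have key (m : ℕ) : ∀ᵐ x ∂ν, |(ν[h | cylAlgebra S m]) x| ≤ C := by
    obtain ⟨c, hc⟩ := exists_eq_of_measurable_cylAlgebra
      (stronglyMeasurable_condExp (μ := ν) (m := cylAlgebra S m) (f := h)).measurable
    have hβ (β : Fin m → S) : ∀ᵐ x ∂ν, x ∈ cylinder β → |c β| ≤ C := by
      rcases (measureReal_nonneg (μ := ν) (s := cylinder β)).eq_or_lt with h0 | h0
      · have h1 : ν (cylinder β) = 0 := (measureReal_eq_zero_iff).1 h0.symm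
        filter_upwards [measure_eq_zero_iff_ae_notMem.1 h1] with x hx hx'
        exact absurd hx' hx
      · refine Eventually.of_forall fun _ _ => ?_
        have h1 : ∫ x in cylinder β, (ν[h | cylAlgebra S m]) x ∂ν = ν.real (cylinder β) * c β := by
          rw [setIntegral_congr_fun (g := fun _ => c β)
            (cylAlgebra_le m _ (measurableSet_cylinder β)) (hc β), setIntegral_const, smul_eq_mul]
        have h2 := hC m β
        rw [← setIntegral_condExp (cylAlgebra_le m) hh (measurableSet_cylinder β), h1, abs_mul,
          abs_of_pos h0, mul_comm] at h2
        exact le_of_mul_le_mul_right h2 h0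
    filter_upwards [ae_all_iff.2 hβ] with x hx
    rw [hc _ x (mem_cylinder_iff.2 rfl)]
    exact hx _ (mem_cylinder_iff.2 rfl)
  have hlim := tendsto_ae_condExp (μ := ν) (ℱ := cylFiltration S) h
  have hsup : ν[h | ⨆ n, cylFiltration S n] =ᵐ[ν] h := by
    have : (⨆ n, cylFiltration S n) = (MeasurableSpace.pi : MeasurableSpace (ℕ → S)) :=
      iSup_cylAlgebra
    rw [this]
    exact condExp_of_aestronglyMeasurable' le_rfl hh.1 hh
  filter_upwards [hlim, hsup, ae_all_iff.2 key] with x h₁ h₂ h₃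
  rw [h₂] at h₁
  exact le_of_tendsto h₁.abs (Eventually.of_forall h₃)

end Cylinders

section Kusuoka

variable {ν : Measure (ℕ → Fin 3)}

lemma measureReal_cylinder
    (hν : ∀ (n : ℕ) (α : Fin n → Fin 3),
      ν (cylinder α) = ENNReal.ofReal ((1 / 2) * (sgW α * (sgW α)ᵀ).trace))
    {n : ℕ} (α : Fin n → Fin 3) :
    ν.real (cylinder α) = 1 / 2 * (sgW α * (sgW α)ᵀ).trace := by
  rw [measureReal_def, hν, ENNReal.toReal_ofReal]
  simp only [Matrix.trace_fin_two, Matrix.mul_apply, Fin.sum_univ_two, Matrix.transpose_apply]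
  nlinarith [sq_nonneg (sgW α 0 0), sq_nonneg (sgW α 0 1), sq_nonneg (sgW α 1 0),
    sq_nonneg (sgW α 1 1)]

lemma measureReal_cylinder_inter_preimage [IsProbabilityMeasure ν]
    (hν : ∀ (n : ℕ) (α : Fin n → Fin 3),
      ν (cylinder α) = ENNReal.ofReal ((1 / 2) * (sgW α * (sgW α)ᵀ).trace))
    (hshift : Measurable (shift : (ℕ → Fin 3) → ℕ → Fin 3))
    {k m : ℕ} (n : ℕ) (α : Fin k → Fin 3) (β : Fin m → Fin 3) :
    ν.real (cylinder α ∩ shift^[n + k] ⁻¹' cylinder β) =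
      (4 / 5) ^ n * (1 / 2 * (sgW α * (sgW β * (sgW β)ᵀ) * (sgW α)ᵀ).trace) +
      (1 - (4 / 5) ^ n) *
        (1 / 4 * (sgW α * (sgW α)ᵀ).trace * (sgW β * (sgW β)ᵀ).trace) := by
  induction n generalizing m with
  | zero =>
    rw [zero_add, ← cylinder_append, measureReal_cylinder hν, sgW_append, Matrix.transpose_mul]
    simp only [Matrix.mul_assoc, pow_zero, one_mul, sub_self, zero_mul, add_zero]
  | succ n ih =>
    have hset : cylinder α ∩ shift^[n + 1 + k] ⁻¹' cylinder β =
        ⋃ s ∈ (Finset.univ : Finset (Fin 3)), cylinder α ∩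
          shift^[n + k] ⁻¹' cylinder (Fin.cons s β : Fin (m + 1) → Fin 3) := by
      rw [add_right_comm, Function.iterate_succ', Set.preimage_comp, shift_preimage_cylinder]
      simp [Set.preimage_iUnion, Set.inter_iUnion]
    have hB : (sgW β * (sgW β)ᵀ)ᵀ = sgW β * (sgW β)ᵀ := by
      rw [Matrix.transpose_mul, Matrix.transpose_transpose]
    have hsum := sum_sgA_conj _ hB
    have hcons (s : Fin 3) : sgW (Fin.cons s β : Fin (m + 1) → Fin 3) *
        (sgW (Fin.cons s β : Fin (m + 1) → Fin 3))ᵀ =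
        sgA s * (sgW β * (sgW β)ᵀ) * (sgA s)ᵀ := by
      rw [sgW_cons, Matrix.transpose_mul]
      simp only [Matrix.mul_assoc]
    rw [hset, measureReal_biUnion_finset]
    · simp only [ih, hcons]
      rw [Finset.sum_add_distrib, ← Finset.mul_sum, ← Finset.mul_sum, ← Finset.mul_sum,
        ← Finset.mul_sum, ← Matrix.trace_sum, ← Matrix.trace_sum, ← Finset.sum_mul,
        ← Finset.mul_sum, hsum]
      simp only [Matrix.mul_add, Matrix.add_mul, Matrix.mul_smul, Matrix.smul_mul,
        Matrix.trace_add, Matrix.trace_smul, Matrix.mul_one, Matrix.trace_one, smul_eq_mul,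
        Fintype.card_fin]
      push_cast
      ring
    · intro s _ t _ hst
      refine Disjoint.mono Set.inter_subset_right Set.inter_subset_right (Disjoint.preimage _ ?_)
      exact disjoint_cylinder fun h => hst (Fin.cons_inj.1 h).1
    · intro s _
      exact (cylAlgebra_le _ _ (measurableSet_cylinder α)).inter
        (hshift.iterate _ (cylAlgebra_le _ _ (measurableSet_cylinder _)))

lemma abs_measureReal_inter_preimage_sub_le [IsProbabilityMeasure ν]
    (hν : ∀ (n : ℕ) (α : Fin n → Fin 3),
      ν (cylinder α) = ENNReal.ofReal ((1 / 2) * (sgW α * (sgW α)ᵀ).trace))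
    (hshift : Measurable (shift : (ℕ → Fin 3) → ℕ → Fin 3))
    {k m : ℕ} (n : ℕ) (α : Fin k → Fin 3) (β : Fin m → Fin 3) :
    |ν.real (cylinder α ∩ shift^[n + k] ⁻¹' cylinder β) -
        ν.real (cylinder α) * ν.real (cylinder β)| ≤
      (4 / 5) ^ n * (ν.real (cylinder α) * ν.real (cylinder β)) := by
  rw [measureReal_cylinder_inter_preimage hν hshift, measureReal_cylinder hν,
    measureReal_cylinder hν]
  have h0 : (0 : ℝ) ≤ (4 / 5) ^ n := by positivity
  have h := mul_le_mul_of_nonneg_left (abs_trace_mul_sub_le (sgW α) (sgW β)) h0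
  generalize (sgW α * (sgW β * (sgW β)ᵀ) * (sgW α)ᵀ).trace = t at h ⊢
  generalize (sgW α * (sgW α)ᵀ).trace = a at h ⊢
  generalize (sgW β * (sgW β)ᵀ).trace = b at h ⊢
  generalize (4 / 5 : ℝ) ^ n = q at h h0 ⊢
  calc |q * (1 / 2 * t) + (1 - q) * (1 / 4 * a * b) - 1 / 2 * a * (1 / 2 * b)|
      = q * |1 / 2 * t - 1 / 4 * a * b| := by
        rw [← abs_of_nonneg h0, ← abs_mul, abs_of_nonneg h0]
        ring_nf
    _ ≤ q * (1 / 4 * a * b) := h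
    _ = q * (1 / 2 * a * (1 / 2 * b)) := by ring

end Kusuoka

/-- The integral of `L^m f` over `E` is the integral of `f` over `T⁻ᵐ E`. -/
lemma setIntegral_transfer_pow {X : Type*} [MeasurableSpace X] {ν : Measure X}
    [IsFiniteMeasure ν] {T : X → X} (hT : MeasurePreserving T ν ν)
    {L : Lp ℝ 2 ν →L[ℝ] Lp ℝ 2 ν}
    (hL : ∀ f g : Lp ℝ 2 ν, ∫ x, (L f) x * g x ∂ν = ∫ x, f x * g (T x) ∂ν)
    (m : ℕ) (f : Lp ℝ 2 ν) {E : Set X} (hE : MeasurableSet E) :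
    ∫ x in E, ((L ^ m) f : Lp ℝ 2 ν) x ∂ν = ∫ x in T^[m] ⁻¹' E, f x ∂ν := by
  have hstep (f : Lp ℝ 2 ν) {E : Set X} (hE : MeasurableSet E) :
      ∫ x in E, (L f) x ∂ν = ∫ x in T ⁻¹' E, f x ∂ν := by
    have hg := indicatorConstLp_coeFn (p := 2) (hs := hE) (hμs := measure_ne_top ν E) (c := (1 : ℝ))
    have h := hL f (indicatorConstLp 2 hE (measure_ne_top ν E) (1 : ℝ))
    rw [← integral_indicator hE, ← integral_indicator (hT.measurable hE)]
    convert h using 1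
    · refine integral_congr_ae ?_
      filter_upwards [hg] with x hx
      rw [hx]
      by_cases hxE : x ∈ E <;> simp [hxE]
    · refine integral_congr_ae ?_
      filter_upwards [hT.quasiMeasurePreserving.ae hg] with x hx
      rw [hx]
      by_cases hxE : T x ∈ E <;> simp [hxE]
  induction m generalizing E with
  | zero => simp
  | succ m ih =>
    rw [pow_succ', mul_apply_eq_comp, hstep _ hE, ih (hT.measurable hE),
      Function.iterate_succ', Set.preimage_comp]

/-- for the Kusuoka measure of the Sierpiński gasket system, for every
`k ≥ 0`, every `𝓕_k`-measurable `f ∈ L¹(X,ν)` and every `n ≥ 0`,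
`‖L^{n+k} f − ∫ f dν‖_{L^∞(ν)} ≤ 2 (4/5)ⁿ ‖f‖_{L¹(ν)}`. -/
theorem sg_transfer_operator_rate
    (ν : Measure (ℕ → Fin 3)) [IsProbabilityMeasure ν]
    (hν : ∀ (n : ℕ) (α : Fin n → Fin 3),
      ν (cylinder α) = ENNReal.ofReal ((1 / 2) * (sgW α * (sgW α)ᵀ).trace))
    (hshift : MeasurePreserving (shift : (ℕ → Fin 3) → ℕ → Fin 3) ν ν)
    (L : Lp ℝ 2 ν →L[ℝ] Lp ℝ 2 ν)
    (hL : ∀ f g : Lp ℝ 2 ν, ∫ x, (L f) x * g x ∂ν = ∫ x, f x * g (shift x) ∂ν)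
    (k n : ℕ) (fo : (ℕ → Fin 3) → ℝ)
    (hfo_meas : Measurable[cylAlgebra (Fin 3) k] fo)
    (hfo_int : Integrable fo ν)
    (f : Lp ℝ 2 ν) (hf : ⇑f =ᵐ[ν] fo) :
    eLpNorm (fun x => ((L ^ (n + k)) f : Lp ℝ 2 ν) x - ∫ y, fo y ∂ν) ⊤ ν ≤
      ENNReal.ofReal (2 * (4 / 5 : ℝ) ^ n * ∫ y, |fo y| ∂ν) := by
  have hm (m : ℕ) (β : Fin m → Fin 3) : MeasurableSet (cylinder β) :=
    cylAlgebra_le m _ (measurableSet_cylinder β)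
  obtain ⟨c, hc⟩ := exists_eq_of_measurable_cylAlgebra hfo_meas
  have hint : ∫ y, fo y ∂ν = ∑ α, c α * ν.real (cylinder α) := by
    simpa using setIntegral_eq_sum_cylinder (ν := ν) hc Set.univ
  have hnorm : ∫ y, |fo y| ∂ν = ∑ α, |c α| * ν.real (cylinder α) := by
    simpa using setIntegral_eq_sum_cylinder (ν := ν) (f := fun x => |fo x|) (c := fun α => |c α|)
      (fun α x hx => congrArg abs (hc α x hx)) Set.univ
  have hLf : Integrable (fun x => ((L ^ (n + k)) f : Lp ℝ 2 ν) x) ν :=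
    (Lp.memLp _).integrable one_le_two
  have hcyl (m : ℕ) (β : Fin m → Fin 3) :
      |∫ x in cylinder β, (((L ^ (n + k)) f : Lp ℝ 2 ν) x - ∫ y, fo y ∂ν) ∂ν| ≤
        ((4 / 5 : ℝ) ^ n * ∫ y, |fo y| ∂ν) * ν.real (cylinder β) := by
    rw [integral_sub hLf.integrableOn (integrable_const _).integrableOn, setIntegral_const,
      setIntegral_transfer_pow hshift hL _ _ (hm m β), integral_congr_ae (ae_restrict_of_ae hf),
      setIntegral_eq_sum_cylinder hc, hint, hnorm,
      smul_eq_mul, Finset.mul_sum, Finset.mul_sum, Finset.sum_mul, ← Finset.sum_sub_distrib]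
    refine (Finset.abs_sum_le_sum_abs _ _).trans (Finset.sum_le_sum fun α _ => ?_)
    have h := mul_le_mul_of_nonneg_left
      (abs_measureReal_inter_preimage_sub_le hν hshift.measurable n α β) (abs_nonneg (c α))
    rw [← abs_mul] at h
    convert h using 1
    · congr 1
      ring
    · ring
  have hbound := ae_abs_le_of_cylinder (hLf.sub (integrable_const _)) hcyl
  rw [eLpNorm_exponent_top]
  refine (eLpNormEssSup_le_of_ae_bound hbound).trans (ENNReal.ofReal_le_ofReal ?_)
  have h0 : 0 ≤ (4 / 5 : ℝ) ^ n * ∫ y, |fo y| ∂ν :=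
    mul_nonneg (by positivity) (integral_nonneg fun _ => abs_nonneg _)
  linarith
end
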